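/- For every finite simple graph G, the limit superior as k → ∞ of the sequence L_{k}(G)/k equals Z*_rlx(G). -/

import Mathlib

open Finset SimpleGraph
open scoped Classical

/-- `f` is a `{k}`-packing function of `G`: the sum of `f` over every closed
neighborhood `N[v] = N(v) ∪ {v}` is at most `k`. -/
def IsKPackingFunction {V : Type*} [Fintype V] (G : SimpleGraph V) (k : ℕ) (f : V → ℕ) : Prop :=
  ∀ v : V, ∑ u ∈ insert v (G.neighborFinset v), f u ≤ k

/-- `L_{k}(G)`: the maximum of `∑ v, f v` over all `{k}`-packing functions `f` of `G`. -/
noncomputable def packingFunctionNumber {V : Type*} [Fintype V] (G : SimpleGraph V) (k : ℕ) : ℕ :=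
  sSup {s : ℕ | ∃ f : V → ℕ, IsKPackingFunction G k f ∧ s = ∑ v, f v}

/-- `Z*_rlx(G)`: the optimum of the LP relaxation of the `{1}`-packing problem. -/
noncomputable def Zrlx {V : Type*} [Fintype V] (G : SimpleGraph V) : ℝ :=
  sSup {s : ℝ | ∃ f : V → ℝ, (∀ v, 0 ≤ f v) ∧
    (∀ v : V, ∑ u ∈ insert v (G.neighborFinset v), f u ≤ 1) ∧ s = ∑ v, f v}

section PackingBounds

variable {V : Type*} [Fintype V] (G : SimpleGraph V)

lemma sum_le_card_mul_of_closedNeighborhood_sum_le {R : Type*} [Semiring R] [PartialOrder R]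
    [IsOrderedRing R] {f : V → R} {c : R} (hf : ∀ v, 0 ≤ f v)
    (h : ∀ v : V, ∑ u ∈ insert v (G.neighborFinset v), f u ≤ c) :
    ∑ v, f v ≤ Fintype.card V * c := by
  rw [← nsmul_eq_mul]
  refine Finset.sum_le_card_nsmul _ _ _ fun v _ => le_trans ?_ (h v)
  exact Finset.single_le_sum (fun u _ => hf u) (Finset.mem_insert_self v _)

lemma IsKPackingFunction.sum_le_packingFunctionNumber {k : ℕ} {f : V → ℕ}
    (hf : IsKPackingFunction G k f) : ∑ v, f v ≤ packingFunctionNumber G k := by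
  refine le_csSup ⟨Fintype.card V * k, ?_⟩ ⟨f, hf, rfl⟩
  rintro _ ⟨g, hg, rfl⟩
  exact sum_le_card_mul_of_closedNeighborhood_sum_le G (fun v => Nat.zero_le _) hg

lemma exists_isKPackingFunction_sum_eq (k : ℕ) :
    ∃ f : V → ℕ, IsKPackingFunction G k f ∧ packingFunctionNumber G k = ∑ v, f v := by
  refine Nat.sSup_mem (s := {s : ℕ | ∃ f : V → ℕ, IsKPackingFunction G k f ∧ s = ∑ v, f v})
    ⟨0, fun _ => 0, fun v => by simp, by simp⟩ ⟨Fintype.card V * k, ?_⟩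
  rintro _ ⟨g, hg, rfl⟩
  exact sum_le_card_mul_of_closedNeighborhood_sum_le G (fun v => Nat.zero_le _) hg

lemma sum_le_Zrlx {f : V → ℝ} (hf : ∀ v, 0 ≤ f v)
    (h : ∀ v : V, ∑ u ∈ insert v (G.neighborFinset v), f u ≤ 1) : ∑ v, f v ≤ Zrlx G := by
  refine le_csSup ⟨Fintype.card V * 1, ?_⟩ ⟨f, hf, h, rfl⟩
  rintro _ ⟨g, hg, hg', rfl⟩
  exact sum_le_card_mul_of_closedNeighborhood_sum_le G hg hg'

lemma packingFunctionNumber_div_le_Zrlx {k : ℕ} (hk : 0 < k) :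
    (packingFunctionNumber G k : ℝ) / k ≤ Zrlx G := by
  obtain ⟨f, hf, hsum⟩ := exists_isKPackingFunction_sum_eq G k
  rw [hsum, Nat.cast_sum, Finset.sum_div]
  refine sum_le_Zrlx G (fun v => by positivity) fun v => ?_
  rw [← Finset.sum_div, div_le_one (by exact_mod_cast hk)]
  exact_mod_cast hf v

lemma Zrlx_sub_card_div_le {k : ℕ} (hk : 0 < k) :
    Zrlx G - (Fintype.card V : ℝ) / k ≤ (packingFunctionNumber G k : ℝ) / k := by
  have hk' : (0 : ℝ) < k := by exact_mod_cast hk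
  rw [sub_le_iff_le_add, ← add_div]
  refine csSup_le ⟨0, fun _ => 0, by simp, by simp, by simp⟩ ?_
  rintro _ ⟨f, hf, h, rfl⟩
  rw [le_div_iff₀ hk']
  have hfloor : IsKPackingFunction G k fun v => ⌊f v * k⌋₊ := fun v => by
    have hle : ∑ u ∈ insert v (G.neighborFinset v), (⌊f u * k⌋₊ : ℝ) ≤ k :=
      calc ∑ u ∈ insert v (G.neighborFinset v), (⌊f u * k⌋₊ : ℝ)
          ≤ ∑ u ∈ insert v (G.neighborFinset v), f u * k :=
            Finset.sum_le_sum fun u _ => Nat.floor_le (mul_nonneg (hf u) hk'.le)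
        _ = (∑ u ∈ insert v (G.neighborFinset v), f u) * k := (Finset.sum_mul _ _ _).symm
        _ ≤ k := mul_le_of_le_one_left hk'.le (h v)
    exact_mod_cast hle
  have hL : (∑ v, (⌊f v * k⌋₊ : ℝ)) ≤ packingFunctionNumber G k := by
    exact_mod_cast hfloor.sum_le_packingFunctionNumber G
  calc (∑ v, f v) * k = ∑ v, f v * k := Finset.sum_mul _ _ _
    _ ≤ ∑ v, ((⌊f v * k⌋₊ : ℝ) + 1) := Finset.sum_le_sum fun v _ => (Nat.lt_floor_add_one _).le
    _ = (∑ v, (⌊f v * k⌋₊ : ℝ)) + Fintype.card V := by simp [Finset.sum_add_distrib]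
    _ ≤ packingFunctionNumber G k + Fintype.card V := by gcongr

lemma tendsto_packingFunctionNumber_div :
    Filter.Tendsto (fun k : ℕ => (packingFunctionNumber G k : ℝ) / (k : ℝ)) Filter.atTop
      (nhds (Zrlx G)) := by
  have hlow : Filter.Tendsto (fun k : ℕ => Zrlx G - (Fintype.card V : ℝ) / k) Filter.atTop
      (nhds (Zrlx G)) := by
    simpa using (tendsto_const_div_atTop_nhds_zero_nat (Fintype.card V : ℝ)).const_sub (Zrlx G)
  refine tendsto_of_tendsto_of_tendsto_of_le_of_le' hlow tendsto_const_nhds ?_ ?_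
  · filter_upwards [Filter.eventually_gt_atTop 0] with k hk using Zrlx_sub_card_div_le G hk
  · filter_upwards [Filter.eventually_gt_atTop 0] with k hk using
      packingFunctionNumber_div_le_Zrlx G hk

end PackingBounds

/-- `limsup_{k → ∞} L_{k}(G)/k = Z*_rlx(G)`. -/
theorem limsup_packingFunctionNumber_div_eq_Zrlx {V : Type*} [Fintype V]
    (G : SimpleGraph V) :
    Filter.limsup (fun k : ℕ => (packingFunctionNumber G k : ℝ) / (k : ℝ)) Filter.atTop
      = Zrlx G :=
  (tendsto_packingFunctionNumber_div G).limsup_eq
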